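/- arXiv:1311.1057 — 3 statements merged into one kernel-verified Lean document; each statement's English description precedes it below -/
import Mathlib

section
/- Let A be a real 3×3 symmetric matrix with trace A = 0. Then det A ≤ (√6/18)·‖A‖³, where ‖A‖ = (Σ_{i,j} A_{ij}²)^{1/2} is the Frobenius norm of A. -/
theorem mul_mul_sq_le_of_add_add_eq_zero {a b c : ℝ} (h : a + b + c = 0) :
    (a * b * c) ^ 2 ≤ (a ^ 2 + b ^ 2 + c ^ 2) ^ 3 / 54 := by
  obtain rfl : c = -a - b := by linarith
  linarith [sq_nonneg ((a - b) * (2 * a + b) * (a + 2 * b))]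

theorem Matrix.IsSymm.exists_roots_fin_three {A : Matrix (Fin 3) (Fin 3) ℝ} (hA : A.IsSymm) :
    ∃ a b c : ℝ, A.det = a * b * c ∧ A.trace = a + b + c ∧
      ∑ i, ∑ j, A i j ^ 2 = a ^ 2 + b ^ 2 + c ^ 2 := by
  have hH : A.IsHermitian := by
    rwa [Matrix.IsHermitian, Matrix.conjTranspose_eq_transpose_of_trivial]
  have hdet : A.det = hH.eigenvalues 0 * hH.eigenvalues 1 * hH.eigenvalues 2 := by
    simpa [Fin.prod_univ_three] using hH.det_eq_prod_eigenvalues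
  have htr : A.trace = hH.eigenvalues 0 + hH.eigenvalues 1 + hH.eigenvalues 2 := by
    simpa [Fin.sum_univ_three] using hH.trace_eq_sum_eigenvalues
  have hchar : (1 - A).det =
      (1 - hH.eigenvalues 0) * (1 - hH.eigenvalues 1) * (1 - hH.eigenvalues 2) := by
    simpa [Matrix.eval_charpoly, Polynomial.eval_prod, Fin.prod_univ_three]
      using congrArg (Polynomial.eval 1) hH.charpoly_eq
  refine ⟨_, _, _, hdet, htr, ?_⟩
  generalize hH.eigenvalues 0 = a, hH.eigenvalues 1 = b, hH.eigenvalues 2 = c at *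
  have h10 : A 1 0 = A 0 1 := hA.apply 0 1
  have h20 : A 2 0 = A 0 2 := hA.apply 0 2
  have h21 : A 2 1 = A 1 2 := hA.apply 1 2
  have hsq : A.trace ^ 2 = (a + b + c) ^ 2 := by rw [htr]
  simp [Matrix.det_fin_three, h10, h20, h21] at hdet hchar
  rw [Matrix.trace_fin_three] at htr hsq
  simp only [Fin.sum_univ_three, h10, h20, h21]
  linarith

/-- For a real symmetric 3×3 matrix with zero trace,
`det A ≤ (√6/18)·‖A‖³` where `‖A‖` is the Frobenius norm. -/
theorem det_le_of_symm_traceless (A : Matrix (Fin 3) (Fin 3) ℝ)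
    (hsymm : A.IsSymm) (htr : A.trace = 0) :
    A.det ≤ (Real.sqrt 6 / 18) * Real.sqrt (∑ i, ∑ j, A i j ^ 2) ^ 3 := by
  obtain ⟨a, b, c, hdet, htrace, hnorm⟩ := hsymm.exists_roots_fin_three
  rw [hdet, hnorm]
  refine le_of_sq_le_sq ?_ (by positivity)
  refine (mul_mul_sq_le_of_add_add_eq_zero (htrace ▸ htr)).trans_eq ?_
  rw [mul_pow, div_pow, Real.sq_sqrt (by norm_num), pow_right_comm, Real.sq_sqrt (by positivity)]
  ring
end

section
/- Let x ≥ 0, y ≥ 0, a > 0 and λ ≥ 0 be real numbers satisfying 4√6·a·(x + y) ≤ 4a² - (25/9)λ². Then (25/9)·λ²·x²·y² - 4·x²·y²·(a - √6·x)·(a - √6·y) ≤ 0. -/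
/-- The discriminant estimate: if `4√6·a·(x + y) ≤ 4a² - (25/9)lam²`, then
`(25/9)·lam²·x²·y² - 4·x²·y²·(a - √6·x)·(a - √6·y) ≤ 0`. -/
theorem discriminant_nonpos (x y a lam : ℝ) (hx : 0 ≤ x) (hy : 0 ≤ y) (ha : 0 < a)
    (hlam : 0 ≤ lam) (h : 4 * Real.sqrt 6 * a * (x + y) ≤ 4 * a ^ 2 - (25 / 9) * lam ^ 2) :
    (25 / 9) * lam ^ 2 * x ^ 2 * y ^ 2
      - 4 * x ^ 2 * y ^ 2 * (a - Real.sqrt 6 * x) * (a - Real.sqrt 6 * y) ≤ 0 := by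
  have key : 0 ≤ 4 * (a - Real.sqrt 6 * x) * (a - Real.sqrt 6 * y) - (25 / 9) * lam ^ 2 := by
    have hxy : 0 ≤ Real.sqrt 6 ^ 2 * (x * y) := by positivity
    linarith
  have hmul := mul_nonneg (by positivity : 0 ≤ x ^ 2 * y ^ 2) key
  linarith
end

section
/- Let x ≥ 0, y ≥ 0, s > 0, λ > 0 and K be real numbers with K ≥ s²/(8(3s + 5λ)) and x + y ≤ √6·(s/6 - 2K), and set a = (5/6)λ + s/2. Then for every real number t, y²·(a - √6·y)·t² - (5/3)·λ·x·y·t + x²·(a - √6·x) ≥ 0. -/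
/-- A quadratic form `A u² - 2 l u v + B v²` with `A > 0` and `l² ≤ A B` is nonnegative. -/
lemma quadratic_form_nonneg {A B l : ℝ} (hA : 0 < A) (h : l ^ 2 ≤ A * B) (u v : ℝ) :
    0 ≤ A * u ^ 2 - 2 * l * u * v + B * v ^ 2 := by
  refine nonneg_of_mul_nonneg_right ?_ hA
  nlinarith [sq_nonneg (A * u - l * v), mul_nonneg (sub_nonneg.2 h) (sq_nonneg v)]


/-- Analytic core of Theorem 3: under the pinching hypotheses, the quadratic
`P(t) = y²(a - √6·y)t² - (5/3)lam·x·y·t + x²(a - √6·x)` is nonnegative for all `t`. -/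
theorem quadratic_nonneg (x y s lam K : ℝ) (hx : 0 ≤ x) (hy : 0 ≤ y)
    (hs : 0 < s) (hlam : 0 < lam) (hK : K ≥ s ^ 2 / (8 * (3 * s + 5 * lam)))
    (hxy : x + y ≤ Real.sqrt 6 * (s / 6 - 2 * K)) :
    ∀ t : ℝ,
      y ^ 2 * (((5 / 6) * lam + s / 2) - Real.sqrt 6 * y) * t ^ 2
        - (5 / 3) * lam * x * y * t
        + x ^ 2 * (((5 / 6) * lam + s / 2) - Real.sqrt 6 * x) ≥ 0 := by
  intro t
  set r := Real.sqrt 6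
  have hr0 : 0 ≤ r := Real.sqrt_nonneg 6
  have hr : r ^ 2 = 6 := Real.sq_sqrt (by norm_num)
  set a := (5 / 6) * lam + s / 2 with ha
  have ha0 : 0 < a := by positivity
  have hK' : s ^ 2 ≤ 48 * a * K := by
    rw [ge_iff_le, div_le_iff₀ (by positivity)] at hK
    rw [ha]
    linarith
  have hsum : r * (x + y) ≤ s - 12 * K := by
    have h := mul_le_mul_of_nonneg_left hxy hr0
    rw [← mul_assoc, ← sq, hr] at h
    linarith
  have hmul : a * (r * (x + y)) ≤ a ^ 2 - (5 / 6 * lam) ^ 2 := by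
    have h := mul_le_mul_of_nonneg_left hsum ha0.le
    have hl : 5 / 6 * lam = a - s / 2 := by rw [ha]; ring
    rw [hl]
    linarith
  have hA : 0 < a - r * y := by
    refine pos_of_mul_pos_right (a := a) ?_ ha0.le
    have hl : 0 < (5 / 6 * lam) ^ 2 := by positivity
    have hrx : 0 ≤ a * (r * x) := by positivity
    linarith
  have hAB : (5 / 6 * lam) ^ 2 ≤ (a - r * y) * (a - r * x) := by
    have hrxy : 0 ≤ (r * x) * (r * y) := by positivity
    linarith
  linarith [quadratic_form_nonneg hA hAB (y * t) x]
end
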